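/- arXiv:2105.08254 — 6 statements merged into one kernel-verified Lean document; each statement's English description precedes it below -/
import Mathlib

section
/- Let F = ℚ(√d) ⊆ ℂ (d < 0 squarefree) with ring of integers 𝒪_F, assumed to be a principal ideal domain, and let δ be the generator of the inverse different as below. Let (Λ,⟨·,·⟩) be a Hermitian lattice over 𝒪_F and let b be a nonzero rational integer. Then there exists a δ𝒪_F-valued Hermitian form h on Λ such that (Λ,h) is a unimodular Hermitian lattice and ⟨v,w⟩ = b·h(v,w) for all v,w ∈ Λ, if and only if for every primitive vector v ∈ Λ the set {⟨v,w⟩ : w ∈ Λ} equals bδ𝒪_F. -/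
noncomputable section

open Complex

/-- `√d := i·√|d|` for a (negative) integer `d`, as a complex number. -/
def sqrtD (d : ℤ) : ℂ := Complex.I * Real.sqrt (|d| : ℝ)

/-- The ring of integers of `F = ℚ(√d)`, realized as the subring of `ℂ` consisting of
elements of `ℚ(√d)` that are integral over `ℤ`. -/
def Oring (d : ℤ) : Subring ℂ :=
  (integralClosure ℤ ℂ).toSubring ⊓ (Algebra.adjoin ℚ {sqrtD d}).toSubring

/-- The generator `δ` of the inverse different of `ℚ(√d)`. -/
def deltaF (d : ℤ) : ℂ := if d % 4 = 1 then 1 / sqrtD d else 1 / (2 * sqrtD d)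

/-- A vector lies in the standard lattice `𝒪_F^n`. -/
def inLat (d : ℤ) {n : ℕ} (v : Fin n → ℂ) : Prop := ∀ j, v j ∈ Oring d

/-- A vector lies in the `F`-span `F^n` of the lattice, i.e. in `Λ ⊗ F`. -/
def inSpanF (d : ℤ) {n : ℕ} (v : Fin n → ℂ) : Prop :=
  ∀ j, v j ∈ Algebra.adjoin ℚ {sqrtD d}

/-- `a` is a unit of `𝒪_F`. -/
def IsUnitO (d : ℤ) (a : ℂ) : Prop :=
  a ∈ Oring d ∧ ∃ b ∈ Oring d, a * b = 1

/-- A sesquilinear form on `ℂ^n` (linear in the first variable, conjugate-linear in the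
second, Hermitian symmetric); this models a Hermitian form on `Λ ⊗ F` extended by scalars. -/
structure SesqForm (n : ℕ) where
  toFun : (Fin n → ℂ) → (Fin n → ℂ) → ℂ
  add_left : ∀ x y w, toFun (x + y) w = toFun x w + toFun y w
  smul_left : ∀ (c : ℂ) (x w), toFun (c • x) w = c * toFun x w
  conj_symm : ∀ v w, toFun w v = (starRingEnd ℂ) (toFun v w)

/-- `(𝒪_F^n, Φ)` is a Hermitian lattice: the form takes values in `δ𝒪_F` on lattice vectors. -/
def IsHermLat (d : ℤ) {n : ℕ} (Φ : SesqForm n) : Prop :=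
  ∀ v w : Fin n → ℂ, inLat d v → inLat d w → ∃ u ∈ Oring d, Φ.toFun v w = deltaF d * u

/-- The Hermitian lattice `(𝒪_F^n, Φ)` is unimodular: its dual lattice
`{v ∈ Λ ⊗ F | ∀ w ∈ Λ, Φ(v,w) ∈ δ𝒪_F}` equals the lattice itself. -/
def IsUnimodular (d : ℤ) {n : ℕ} (Φ : SesqForm n) : Prop :=
  ∀ v : Fin n → ℂ,
    (inSpanF d v ∧ ∀ w, inLat d w → ∃ u ∈ Oring d, Φ.toFun v w = deltaF d * u) ↔ inLat d v

/-- A lattice vector `r` is primitive: `r = a • v` with `a ∈ 𝒪_F`, `v ∈ Λ` forces `a ∈ 𝒪_F^×`. -/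
def Primitive (d : ℤ) {n : ℕ} (r : Fin n → ℂ) : Prop :=
  inLat d r ∧ ∀ (a : ℂ) (v : Fin n → ℂ), a ∈ Oring d → inLat d v → r = a • v → IsUnitO d a

lemma sqrtD_sq {d : ℤ} (hd : d < 0) : sqrtD d * sqrtD d = (d : ℂ) := by
  have h : (Real.sqrt (|d| : ℝ) : ℂ) * (Real.sqrt (|d| : ℝ) : ℂ) = -(d : ℂ) := by
    rw [← Complex.ofReal_mul, Real.mul_self_sqrt (abs_nonneg _),
      abs_of_neg (by exact_mod_cast hd)]
    push_cast
    rfl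
  unfold sqrtD
  linear_combination (Complex.I * Complex.I) * h - (d : ℂ) * Complex.I_mul_I

lemma sqrtD_ne {d : ℤ} (hd : d < 0) : sqrtD d ≠ 0 := by
  intro h
  have := sqrtD_sq hd
  rw [h] at this
  have h2 : (d : ℂ) = 0 := by simpa using this.symm
  have : d = 0 := by exact_mod_cast h2
  omega

lemma deltaF_ne {d : ℤ} (hd : d < 0) : deltaF d ≠ 0 := by
  have := sqrtD_ne hd
  unfold deltaF
  split_ifs <;> simp [this]

lemma sqrtD_conj (d : ℤ) : (starRingEnd ℂ) (sqrtD d) = - sqrtD d := by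
  simp [sqrtD]

lemma mem_Oring {d : ℤ} {x : ℂ} :
    x ∈ Oring d ↔ IsIntegral ℤ x ∧ x ∈ Algebra.adjoin ℚ {sqrtD d} := Iff.rfl

lemma conj_mem_F {d : ℤ} {x : ℂ} (hx : x ∈ Algebra.adjoin ℚ {sqrtD d}) :
    (starRingEnd ℂ) x ∈ Algebra.adjoin ℚ {sqrtD d} := by
  induction hx using Algebra.adjoin_induction with
  | mem x hx =>
    rw [Set.mem_singleton_iff.1 hx, sqrtD_conj]
    exact neg_mem (Algebra.subset_adjoin rfl)
  | algebraMap r =>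
    have : (starRingEnd ℂ) (algebraMap ℚ ℂ r) = algebraMap ℚ ℂ r := by simp
    rw [this]
    exact Subalgebra.algebraMap_mem _ r
  | add x y _ _ hx hy => rw [map_add]; exact add_mem hx hy
  | mul x y _ _ hx hy => rw [map_mul]; exact mul_mem hx hy

lemma conj_mem_O {d : ℤ} {x : ℂ} (hx : x ∈ Oring d) : (starRingEnd ℂ) x ∈ Oring d := by
  rw [mem_Oring] at *
  exact ⟨hx.1.map (starRingEnd ℂ).toIntAlgHom, conj_mem_F hx.2⟩

lemma alg_F {d : ℤ} (hd : d < 0) {x : ℂ} (hx : x ∈ Algebra.adjoin ℚ {sqrtD d}) :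
    IsIntegral ℚ x := by
  have hs : IsIntegral ℚ (sqrtD d) := by
    refine IsIntegral.of_pow (n := 2) (by norm_num) ?_
    rw [pow_two, sqrtD_sq hd]
    have h := isIntegral_algebraMap (R := ℚ) (A := ℂ) (x := (d : ℚ))
    rwa [map_intCast] at h
  have : Algebra.adjoin ℚ {sqrtD d} ≤ integralClosure ℚ ℂ :=
    Algebra.adjoin_le (Set.singleton_subset_iff.2 hs)
  exact this hx

lemma inv_mem_F {d : ℤ} (hd : d < 0) {x : ℂ} (hx : x ∈ Algebra.adjoin ℚ {sqrtD d}) :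
    x⁻¹ ∈ Algebra.adjoin ℚ {sqrtD d} :=
  Subalgebra.inv_mem_of_algebraic (Algebra.adjoin ℚ {sqrtD d}) (x := ⟨x, hx⟩)
    (by simpa using (alg_F hd hx).isAlgebraic)

lemma denom_F {d : ℤ} (hd : d < 0) {x : ℂ} (hx : x ∈ Algebra.adjoin ℚ {sqrtD d}) :
    ∃ c : ℤ, c ≠ 0 ∧ (c : ℂ) * x ∈ Oring d := by
  have h1 : IsAlgebraic ℤ x :=
    (IsFractionRing.isAlgebraic_iff ℤ ℚ ℂ).2 (alg_F hd hx).isAlgebraic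
  obtain ⟨c, hc, h⟩ := h1.exists_integral_multiple
  refine ⟨c, hc, mem_Oring.2 ⟨by simpa using h, ?_⟩⟩
  exact mul_mem (intCast_mem _ c) hx

lemma denom_vec {d : ℤ} (hd : d < 0) {n : ℕ} {v : Fin n → ℂ} (hv : inSpanF d v) :
    ∃ c : ℤ, c ≠ 0 ∧ inLat d ((c : ℂ) • v) := by
  choose c hc h using fun j => denom_F hd (hv j)
  refine ⟨∏ j, c j, Finset.prod_ne_zero_iff.2 fun j _ => hc j, fun j => ?_⟩
  obtain ⟨e, he⟩ := Finset.dvd_prod_of_mem c (Finset.mem_univ j)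
  rw [he]
  have : (((c j * e : ℤ) : ℂ) • v) j = (e : ℂ) * ((c j : ℂ) * v j) := by
    simp; ring
  rw [this]
  exact mul_mem (intCast_mem _ e) (h j)

lemma two_not_unit {d : ℤ} : ¬ IsUnitO d 2 := by
  rintro ⟨_, y, hy, h⟩
  have hy' : y = algebraMap ℚ ℂ (1/2) := by
    simp
    linear_combination h / 2
  have h1 : IsIntegral ℤ (algebraMap ℚ ℂ (1/2)) := hy' ▸ (mem_Oring.1 hy).1
  have h2 : IsIntegral ℤ (1/2 : ℚ) :=
    (isIntegral_algebraMap_iff (algebraMap ℚ ℂ).injective).1 h1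
  obtain ⟨m, hm⟩ := IsIntegrallyClosed.isIntegral_iff.1 h2
  have h3 : (m : ℚ) = 1/2 := by simpa using hm
  have h4 : (2 * m : ℚ) = 1 := by linarith
  have h5 : 2 * m = 1 := by exact_mod_cast h4
  omega

namespace SesqForm
variable {n : ℕ} (Φ : SesqForm n)

lemma add_right (v x y : Fin n → ℂ) : Φ.toFun v (x + y) = Φ.toFun v x + Φ.toFun v y := by
  rw [Φ.conj_symm, Φ.add_left, map_add, ← Φ.conj_symm, ← Φ.conj_symm]

lemma smul_right (c : ℂ) (v x : Fin n → ℂ) :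
    Φ.toFun v (c • x) = (starRingEnd ℂ) c * Φ.toFun v x := by
  rw [Φ.conj_symm, Φ.smul_left, map_mul, ← Φ.conj_symm]

lemma sum_left (v w : Fin n → ℂ) :
    Φ.toFun v w = ∑ j, v j * Φ.toFun (Pi.single j 1) w := by
  let L : (Fin n → ℂ) →ₗ[ℂ] ℂ :=
    { toFun := fun v => Φ.toFun v w
      map_add' := fun x y => Φ.add_left x y w
      map_smul' := fun c x => Φ.smul_left c x w }
  have := L.pi_apply_eq_sum_univ v
  have e : ∀ j : Fin n, (fun i => if j = i then (1 : ℂ) else 0) = Pi.single j 1 := by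
    intro j; ext i; simp [Pi.single_apply, eq_comm]
  simpa [L, e] using this

/-- The form multiplied by the inverse of an integer. -/
def divInt (b : ℤ) : SesqForm n where
  toFun v w := (b : ℂ)⁻¹ * Φ.toFun v w
  add_left x y w := by rw [Φ.add_left]; ring
  smul_left c x w := by rw [Φ.smul_left]; ring
  conj_symm v w := by rw [Φ.conj_symm v w]; simp

end SesqForm

lemma primitive_single (d : ℤ) {n : ℕ} (j : Fin n) :
    Primitive d (Pi.single j 1 : Fin n → ℂ) := by
  refine ⟨fun i => ?_, fun a v ha hv h => ⟨ha, v j, hv j, ?_⟩⟩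
  · rw [Pi.single_apply]
    split_ifs
    · exact one_mem _
    · exact zero_mem _
  · have := congrFun h j
    simpa using this.symm

lemma exists_primitive {d : ℤ} (hpid : IsPrincipalIdealRing (Oring d)) {n : ℕ}
    {v : Fin n → ℂ} (hv : inLat d v) (h0 : v ≠ 0) :
    ∃ g ∈ Oring d, ∃ r, Primitive d r ∧ v = g • r := by
  let u : Fin n → Oring d := fun j => ⟨v j, hv j⟩
  obtain ⟨g, hg⟩ := (hpid.principal (Ideal.span (Set.range u))).principal
  have hg : Ideal.span (Set.range u) = Ideal.span {g} := hg
  have hdiv : ∀ j, g ∣ u j := fun j =>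
    Ideal.mem_span_singleton.1 (hg ▸ Ideal.subset_span ⟨j, rfl⟩)
  choose r hr using hdiv
  have hgm : g ∈ Ideal.span (Set.range u) := hg ▸ Ideal.mem_span_singleton_self g
  obtain ⟨s, hs⟩ := (Ideal.mem_span_range_iff_exists_fun).1 hgm
  have hg0 : g ≠ 0 := by
    rintro rfl
    apply h0
    ext j
    have := congrArg Subtype.val (hr j)
    simpa [u] using this
  have h1 : ∑ j, s j * r j = 1 := by
    apply mul_left_cancel₀ hg0
    rw [mul_one]
    conv_rhs => rw [← hs]
    rw [Finset.mul_sum]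
    refine Finset.sum_congr rfl fun j _ => ?_
    rw [hr j]; ring
  refine ⟨g, g.2, fun j => (r j : ℂ), ⟨fun j => (r j).2, fun a w ha hw h => ⟨ha,
    ∑ j, (s j : ℂ) * w j, sum_mem fun j _ => mul_mem (s j).2 (hw j), ?_⟩⟩, ?_⟩
  · have h2 : (∑ j, (s j : ℂ) * (r j : ℂ)) = 1 := by
      have := congrArg Subtype.val h1
      simpa using this
    rw [← h2, Finset.mul_sum]
    refine Finset.sum_congr rfl fun j _ => ?_
    have := congrFun h j
    simp only [Pi.smul_apply, smul_eq_mul] at this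
    rw [this]; ring
  · ext j
    have := congrArg Subtype.val (hr j)
    simpa [u] using this

/-- The ideal of values of `Ψ(r, ·)`, divided by `δ`. -/
def valIdeal (d : ℤ) {n : ℕ} (Ψ : SesqForm n) (r : Fin n → ℂ) : Ideal (Oring d) where
  carrier := {u | ∃ w, inLat d w ∧ Ψ.toFun r w = deltaF d * u}
  zero_mem' := ⟨0, fun _ => zero_mem _, by
    have := Ψ.smul_right 0 r 0
    simpa using this⟩
  add_mem' := by
    rintro x y ⟨w, hw, h⟩ ⟨w', hw', h'⟩
    refine ⟨w + w', fun j => add_mem (hw j) (hw' j), ?_⟩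
    rw [Ψ.add_right, h, h']
    push_cast
    ring
  smul_mem' := by
    rintro c x ⟨w, hw, h⟩
    refine ⟨(starRingEnd ℂ) (c : ℂ) • w, fun j => mul_mem (conj_mem_O c.2) (hw j), ?_⟩
    rw [Ψ.smul_right, h]
    simp
    ring

/-- For a Hermitian lattice `(Λ, ⟨·,·⟩)` over `𝒪_F` (with `𝒪_F` a PID) and a
nonzero rational integer `b`, there is a (`δ𝒪_F`-valued) unimodular Hermitian form `h` on `Λ`
with `⟨v,w⟩ = b·h(v,w)` for all `v, w ∈ Λ` if and only if for every primitive vector `v ∈ Λ`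
the set `{⟨v,w⟩ : w ∈ Λ}` equals `bδ𝒪_F`. -/
theorem herm_lattice_scaled_unimodular_iff
    (d : ℤ) (hd : d < 0) (hsf : Squarefree d)
    (hpid : IsPrincipalIdealRing (Oring d))
    (n : ℕ) (Φ : SesqForm n) (hΦ : IsHermLat d Φ)
    (b : ℤ) (hb : b ≠ 0) :
    (∃ Ψ : SesqForm n, IsHermLat d Ψ ∧ IsUnimodular d Ψ ∧
        ∀ v w : Fin n → ℂ, inLat d v → inLat d w →
          Φ.toFun v w = (b : ℂ) * Ψ.toFun v w) ↔
      (∀ r : Fin n → ℂ, Primitive d r →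
        {z : ℂ | ∃ w, inLat d w ∧ z = Φ.toFun r w} =
          {z : ℂ | ∃ u ∈ Oring d, z = (b : ℂ) * deltaF d * u}) := by
  have hbC : (b : ℂ) ≠ 0 := by exact_mod_cast hb
  have hδ := deltaF_ne hd
  constructor
  · rintro ⟨Ψ, hΨ, hU, hΦΨ⟩ r hr
    ext z
    constructor
    · rintro ⟨w, hw, rfl⟩
      obtain ⟨u, hu, h⟩ := hΨ r w hr.1 hw
      exact ⟨u, hu, by rw [hΦΨ r w hr.1 hw, h]; ring⟩
    · rintro ⟨u, hu, rfl⟩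
      obtain ⟨g, hg⟩ := (hpid.principal (valIdeal d Ψ r)).principal
      have hg : valIdeal d Ψ r = Ideal.span {g} := hg
      -- any nonzero `x` dividing all values is a unit
      have key : ∀ x : Oring d, x ≠ 0 → x ∣ g → IsUnitO d x := by
        intro x hx hxg
        have hx' : (x : ℂ) ≠ 0 := by simpa using hx
        refine hr.2 x ((x : ℂ)⁻¹ • r) x.2 ?_ ?_
        · refine (hU _).1 ⟨fun j => mul_mem (inv_mem_F hd (mem_Oring.1 x.2).2)
            (mem_Oring.1 (hr.1 j)).2, fun w hw => ?_⟩
          obtain ⟨t, ht, h⟩ := hΨ r w hr.1 hw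
          have hm : (⟨t, ht⟩ : Oring d) ∈ valIdeal d Ψ r := ⟨w, hw, h⟩
          rw [hg, Ideal.mem_span_singleton] at hm
          obtain ⟨q, hq⟩ := hxg.trans hm
          have hq' : t = x * q := congrArg Subtype.val hq
          refine ⟨q, q.2, ?_⟩
          rw [Ψ.smul_left, h, hq']
          field_simp
        · rw [smul_smul, mul_inv_cancel₀ hx', one_smul]
      have hg0 : g ≠ 0 := by
        rintro rfl
        have h2 : (2 : Oring d) ≠ 0 := by
          intro h
          have := congrArg Subtype.val h
          simp at this
        exact two_not_unit (d := d) (key 2 h2 (dvd_zero _))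
      obtain ⟨_, e, he, hge⟩ := key g hg0 dvd_rfl
      have hm : (⟨u, hu⟩ : Oring d) ∈ valIdeal d Ψ r := by
        rw [hg, Ideal.mem_span_singleton]
        refine ⟨⟨e, he⟩ * ⟨u, hu⟩, Subtype.ext ?_⟩
        simp only [Subring.coe_mul]
        rw [← mul_assoc, hge, one_mul]
      obtain ⟨w, hw, h⟩ := hm
      exact ⟨w, hw, by rw [hΦΨ r w hr.1 hw, h]; ring⟩
  · intro H
    have hL : IsHermLat d (Φ.divInt b) := by
      intro v w hv hw
      have : ∀ j : Fin n, ∃ u ∈ Oring d, Φ.toFun (Pi.single j 1) w = (b : ℂ) * deltaF d * u :=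
        fun j => (H _ (primitive_single d j)).subset ⟨w, hw, rfl⟩
      choose u hu h using this
      refine ⟨∑ j, v j * u j, sum_mem fun j _ => mul_mem (hv j) (hu j), ?_⟩
      change (b : ℂ)⁻¹ * Φ.toFun v w = _
      rw [Φ.sum_left, Finset.mul_sum, Finset.mul_sum]
      refine Finset.sum_congr rfl fun j _ => ?_
      rw [h j]
      field_simp
    refine ⟨Φ.divInt b, hL, fun v => ⟨?_, fun hv => ⟨fun j => (mem_Oring.1 (hv j)).2,
      fun w hw => hL v w hv hw⟩⟩, fun v w _ _ => ?_⟩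
    · rintro ⟨hv, hdual⟩
      by_cases h0 : v = 0
      · rw [h0]
        exact fun _ => zero_mem _
      obtain ⟨c, hc, hcv⟩ := denom_vec hd hv
      have hcC : (c : ℂ) ≠ 0 := by exact_mod_cast hc
      obtain ⟨g, hg, r, hr, hgr⟩ := exists_primitive hpid hcv (smul_ne_zero hcC h0)
      have hvr : v = ((c : ℂ)⁻¹ * g) • r := by
        rw [← smul_smul, ← hgr, smul_smul, inv_mul_cancel₀ hcC, one_smul]
      obtain ⟨w, hw, h⟩ := (H r hr).superset ⟨1, one_mem _, rfl⟩
      obtain ⟨u, hu, h'⟩ := hdual w hw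
      have h2 : (c : ℂ)⁻¹ * g = u := by
        rw [hvr, SesqForm.smul_left] at h'
        change _ * ((b : ℂ)⁻¹ * Φ.toFun r w) = _ at h'
        rw [← h] at h'
        apply mul_left_cancel₀ hδ
        rw [← h']
        field_simp
      rw [hvr, h2]
      exact fun j => mul_mem hu (hr.1 j)
    · change _ = (b : ℂ) * ((b : ℂ)⁻¹ * Φ.toFun v w)
      rw [mul_inv_cancel_left₀ hbC]
end
end

section
/- Let (Λ,⟨·,·⟩) be an even unimodular Hermitian lattice over ℤ[i]. Then for every primitive vector r ∈ Λ with ⟨r,r⟩ = −1, the quasi-reflection τ_{r,i} does not map Λ into Λ: there exists ℓ ∈ Λ with τ_{r,i}(ℓ) = ℓ + (1−i)⟨ℓ,r⟩·r ∉ Λ. In particular τ_{r,i} ∉ U(Λ). -/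
noncomputable section

open Complex

/-- `z` is a Gaussian integer, i.e. lies in `ℤ[i] ⊆ ℂ`. -/
def inGZ (z : ℂ) : Prop := ∃ a b : ℤ, z = (a : ℂ) + (b : ℂ) * Complex.I

/-- `z` lies in `F = ℚ(i) ⊆ ℂ`. -/
def inQi (z : ℂ) : Prop := ∃ a b : ℚ, z = (a : ℂ) + (b : ℂ) * Complex.I

/-- A vector lies in the standard lattice `ℤ[i]^n`. -/
def inGZlat {n : ℕ} (v : Fin n → ℂ) : Prop := ∀ j, inGZ (v j)

/-- A vector lies in the `ℚ(i)`-span of the lattice, i.e. in `Λ ⊗ F`. -/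
def inQilat {n : ℕ} (v : Fin n → ℂ) : Prop := ∀ j, inQi (v j)

/-- `(ℤ[i]^n, Φ)` is a Hermitian lattice over `ℤ[i]`: the form takes values in
`δℤ[i] = (1/(2i))ℤ[i]` on lattice vectors. -/
def IsHermLatGZ {n : ℕ} (Φ : SesqForm n) : Prop :=
  ∀ v w : Fin n → ℂ, inGZlat v → inGZlat w →
    ∃ g : ℂ, inGZ g ∧ Φ.toFun v w = (1 / (2 * Complex.I)) * g

/-- The Hermitian lattice is even: `⟨v,v⟩ ∈ ℤ` for every lattice vector `v`. -/
def IsEvenGZ {n : ℕ} (Φ : SesqForm n) : Prop :=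
  ∀ v, inGZlat v → ∃ m : ℤ, Φ.toFun v v = (m : ℂ)

/-- The Hermitian lattice `(ℤ[i]^n, Φ)` is unimodular: its dual lattice
`{v ∈ Λ ⊗ F | ∀ w ∈ Λ, ⟨v,w⟩ ∈ δℤ[i]}` equals the lattice itself. -/
def IsUnimodularGZ {n : ℕ} (Φ : SesqForm n) : Prop :=
  ∀ v : Fin n → ℂ,
    (inQilat v ∧ ∀ w, inGZlat w →
      ∃ g : ℂ, inGZ g ∧ Φ.toFun v w = (1 / (2 * Complex.I)) * g) ↔ inGZlat v

/-- A lattice vector `r` is primitive: `r = a • v` with `a ∈ ℤ[i]`, `v ∈ Λ` forces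
`a ∈ ℤ[i]^×`. -/
def PrimitiveGZ {n : ℕ} (r : Fin n → ℂ) : Prop :=
  inGZlat r ∧ ∀ (a : ℂ) (v : Fin n → ℂ), inGZ a → inGZlat v → r = a • v →
    ∃ b : ℂ, inGZ b ∧ a * b = 1

/-- Let `(Λ,⟨·,·⟩)` be an even unimodular Hermitian lattice over `ℤ[i]`.
For every primitive `r ∈ Λ` with `⟨r,r⟩ = -1`, the quasi-reflection `τ_{r,i}` does not map `Λ`
into `Λ`: there is `ℓ ∈ Λ` with `τ_{r,i}(ℓ) = ℓ + (1-i)⟨ℓ,r⟩·r ∉ Λ`. In particular,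
`τ_{r,i} ∉ U(Λ)`. -/
theorem quasiReflection_i_not_mapsTo
    (n : ℕ) (Φ : SesqForm n) (hΦ : IsHermLatGZ Φ)
    (heven : IsEvenGZ Φ) (huni : IsUnimodularGZ Φ)
    (r : Fin n → ℂ) (hr : PrimitiveGZ r) (hrr : Φ.toFun r r = -1) :
    ∃ ℓ : Fin n → ℂ, inGZlat ℓ ∧
      ¬ inGZlat (ℓ + ((1 - Complex.I) * Φ.toFun ℓ r) • r) := by
  by_contra hcon
  push Not at hcon
  obtain ⟨hrl, hprim⟩ := hr
  have I2 : Complex.I ^ 2 = -1 := Complex.I_sq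
  have hI : (Complex.I)⁻¹ = -Complex.I := Complex.inv_I
  have key : ¬ inGZlat (((1 - Complex.I) / 2) • r) := by
    intro hv
    obtain ⟨b, ⟨x, y, rfl⟩, hb⟩ := hprim (1 + Complex.I) _ ⟨1, 1, by simp⟩ hv (by
      rw [smul_smul]
      have : (1 + Complex.I) * ((1 - Complex.I) / 2) = 1 := by
        linear_combination (-1 / 2) * I2
      rw [this, one_smul])
    have h1 := congrArg Complex.re hb
    have h2 := congrArg Complex.im hb
    simp at h1 h2
    norm_cast at h1 h2
    omega
  refine key ((huni _).1 ⟨?_, ?_⟩)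
  · intro j
    obtain ⟨x, y, hxy⟩ := hrl j
    refine ⟨(x + y) / 2, (y - x) / 2, ?_⟩
    simp only [Pi.smul_apply, smul_eq_mul, hxy]
    push_cast
    linear_combination (-(y : ℂ) / 2) * I2
  · intro w hw
    obtain ⟨g, ⟨a, b, rfl⟩, hg⟩ := hΦ r w hrl hw
    rcases Int.even_or_odd' (a + b) with ⟨k, hk | hk⟩
    · have hb : (b : ℂ) = 2 * k - a := by
        have : b = 2 * k - a := by omega
        rw [this]; push_cast; ring
      refine ⟨_, ⟨k, b - k, rfl⟩, ?_⟩
      rw [Φ.smul_left, hg]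
      push_cast
      rw [hb]
      linear_combination (1 / (2 * Complex.I)) * (-(2 * k - a : ℂ) / 2) * I2
    · exfalso
      apply key
      intro j
      have hb : (b : ℂ) = 2 * k + 1 - a := by
        have : b = 2 * k + 1 - a := by omega
        rw [this]; push_cast; ring
      have hwr : Φ.toFun w r = ((b : ℂ) + a * Complex.I) / 2 := by
        rw [Φ.conj_symm r w, hg]
        have c2 : (starRingEnd ℂ) 2 = 2 := Complex.conj_ofNat 2
        simp [hI, c2]
        linear_combination (-(b : ℂ) / 2) * I2
      obtain ⟨x, y, hxy⟩ := hrl j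
      obtain ⟨p, q, hpq⟩ := hw j
      obtain ⟨s, t, hst⟩ := hcon w hw j
      refine ⟨t - q - k * y - (a - k - 1) * x, -(s - p - k * x + (a - k - 1) * y), ?_⟩
      simp only [Pi.add_apply, Pi.smul_apply, smul_eq_mul, hxy, hpq, hwr, hb] at hst ⊢
      apply Complex.ext
      · have h2 := congrArg Complex.im hst
        simp at h2 ⊢
        linarith
      · have h1 := congrArg Complex.re hst
        simp at h1 ⊢
        linarith
end
end

section
/- For the Hermitian lattice Λ₆ = ℤ[i]⁶ with Gram matrix G as below: for every r ∈ Λ₆ with ⟨r,r⟩ = −1, the reflection τ_{r,−1}, given by τ_{r,−1}(ℓ) = ℓ + 2⟨ℓ,r⟩·r, maps Λ₆ into Λ₆; consequently τ_{r,−1} ∈ U(Λ₆). -/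
noncomputable section

open Complex

/-- A vector lies in the lattice `Λ₆ = ℤ[i]⁶`. -/
def lat6 (v : Fin 6 → ℂ) : Prop := ∀ j, inGZ (v j)

/-- The Gram matrix `G`: block diagonal with blocks `G₁ = (1/2)[[0,1+i],[1-i,0]]` (the Gram
matrix of `Λ_{U⊕U(2)}`) and `G₂ = -[[2,-i,-i,1],[i,2,1,i],[i,1,2,1],[1,-i,1,2]]` (the Gram
matrix of `Λ_{E8(-1)}(2)`). -/
def G6 : Matrix (Fin 6) (Fin 6) ℂ :=
  !![0, (1 + Complex.I) / 2, 0, 0, 0, 0;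
     (1 - Complex.I) / 2, 0, 0, 0, 0, 0;
     0, 0, -2, Complex.I, Complex.I, -1;
     0, 0, -Complex.I, -2, -1, -Complex.I;
     0, 0, -Complex.I, -1, -2, -1;
     0, 0, -1, Complex.I, -1, -2]

/-- The Hermitian form `⟨v,w⟩ = Σ_{j,k} G_{jk} v_j conj(w_k)` on `ℂ⁶`. -/
def herm6 (v w : Fin 6 → ℂ) : ℂ :=
  ∑ j : Fin 6, ∑ k : Fin 6, G6 j k * v j * (starRingEnd ℂ) (w k)

theorem inGZ_add {x y : ℂ} (hx : inGZ x) (hy : inGZ y) : inGZ (x + y) := by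
  obtain ⟨a, b, rfl⟩ := hx
  obtain ⟨c, d, rfl⟩ := hy
  exact ⟨a + c, b + d, by push_cast; ring⟩

theorem inGZ_mul {x y : ℂ} (hx : inGZ x) (hy : inGZ y) : inGZ (x * y) := by
  obtain ⟨a, b, rfl⟩ := hx
  obtain ⟨c, d, rfl⟩ := hy
  refine ⟨a * c - b * d, a * d + b * c, ?_⟩
  push_cast
  linear_combination (b * d : ℂ) * Complex.I_mul_I

theorem inGZ_conj {x : ℂ} (hx : inGZ x) : inGZ ((starRingEnd ℂ) x) := by
  obtain ⟨a, b, rfl⟩ := hx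
  exact ⟨a, -b, by simp⟩

theorem inGZ_sum {n : ℕ} (f : Fin n → ℂ) (h : ∀ j, inGZ (f j)) : inGZ (∑ j, f j) :=
  Finset.sum_induction f inGZ (fun _ _ => inGZ_add) ⟨0, 0, by simp⟩ (fun j _ => h j)

/-- Twice the Gram matrix has Gaussian integer entries. -/
theorem inGZ_two_G6 (j k : Fin 6) : inGZ (2 * G6 j k) := by
  have h0 : inGZ (2 * 0) := ⟨0, 0, by simp⟩
  have h1 : inGZ (2 * ((1 + Complex.I) / 2)) := ⟨1, 1, by push_cast; ring⟩
  have h2 : inGZ (2 * ((1 - Complex.I) / 2)) := ⟨1, -1, by push_cast; ring⟩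
  have h3 : inGZ (2 * -2) := ⟨-4, 0, by push_cast; ring⟩
  have h4 : inGZ (2 * Complex.I) := ⟨0, 2, by push_cast; ring⟩
  have h5 : inGZ (2 * -Complex.I) := ⟨0, -2, by push_cast; ring⟩
  have h6 : inGZ (2 * -1) := ⟨-2, 0, by push_cast; ring⟩
  fin_cases j <;> fin_cases k <;> first
    | exact h0 | exact h1 | exact h2 | exact h3 | exact h4 | exact h5 | exact h6

theorem inGZ_two_herm6 {v w : Fin 6 → ℂ} (hv : lat6 v) (hw : lat6 w) :
    inGZ (2 * herm6 v w) := by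
  unfold herm6
  rw [Finset.mul_sum]
  refine inGZ_sum _ fun j => ?_
  rw [Finset.mul_sum]
  refine inGZ_sum _ fun k => ?_
  rw [← mul_assoc, ← mul_assoc]
  exact inGZ_mul (inGZ_mul (inGZ_two_G6 j k) (hv j)) (inGZ_conj (hw k))

theorem G6_conj (j k : Fin 6) : (starRingEnd ℂ) (G6 j k) = G6 k j := by
  have h2 : (starRingEnd ℂ) 2 = 2 := map_ofNat _ 2
  fin_cases j <;> fin_cases k <;> simp [G6, sub_eq_add_neg, h2]

theorem herm6_conj (v w : Fin 6 → ℂ) : (starRingEnd ℂ) (herm6 v w) = herm6 w v := by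
  unfold herm6
  rw [map_sum, Finset.sum_congr rfl fun j _ => map_sum (starRingEnd ℂ) _ _, Finset.sum_comm]
  refine Finset.sum_congr rfl fun j _ => Finset.sum_congr rfl fun k _ => ?_
  rw [map_mul, map_mul, G6_conj, Complex.conj_conj]
  ring

theorem herm6_add_smul (v r w : Fin 6 → ℂ) (c : ℂ) :
    herm6 (v + c • r) w = herm6 v w + c * herm6 r w := by
  unfold herm6
  simp only [Finset.mul_sum, ← Finset.sum_add_distrib, Pi.add_apply, Pi.smul_apply, smul_eq_mul]
  refine Finset.sum_congr rfl fun j _ => Finset.sum_congr rfl fun k _ => ?_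
  ring

theorem herm6_add_smul_right (v r w : Fin 6 → ℂ) (c : ℂ) :
    herm6 w (v + c • r) = herm6 w v + (starRingEnd ℂ) c * herm6 w r := by
  rw [← herm6_conj, herm6_add_smul, map_add, map_mul, herm6_conj, herm6_conj]

/-- For every `r ∈ Λ₆` with `⟨r,r⟩ = -1`, the reflection
`τ_{r,-1} : ℓ ↦ ℓ + 2⟨ℓ,r⟩·r` maps `Λ₆` into `Λ₆`; consequently `τ_{r,-1} ∈ U(Λ₆)`, i.e. it
restricts to a (ℤ[i]-linear) automorphism of `Λ₆` preserving `⟨·,·⟩`. -/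
theorem reflection_neg_one_mem_unitary_lat6
    (r : Fin 6 → ℂ) (hr : lat6 r) (hrr : herm6 r r = -1) :
    (∀ ℓ, lat6 ℓ → lat6 (ℓ + (2 * herm6 ℓ r) • r)) ∧
    Set.BijOn (fun ℓ : Fin 6 → ℂ => ℓ + (2 * herm6 ℓ r) • r) {v | lat6 v} {v | lat6 v} ∧
    (∀ v w : Fin 6 → ℂ, lat6 v → lat6 w →
      herm6 (v + (2 * herm6 v r) • r) (w + (2 * herm6 w r) • r) = herm6 v w) := by
  have hmap : ∀ ℓ, lat6 ℓ → lat6 (ℓ + (2 * herm6 ℓ r) • r) := fun ℓ hℓ j =>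
    inGZ_add (hℓ j) (inGZ_mul (inGZ_two_herm6 hℓ hr) (hr j))
  have hinv : ∀ ℓ : Fin 6 → ℂ, (ℓ + (2 * herm6 ℓ r) • r) +
      (2 * herm6 (ℓ + (2 * herm6 ℓ r) • r) r) • r = ℓ := by
    intro ℓ
    rw [herm6_add_smul, hrr]
    ext j
    simp only [Pi.add_apply, Pi.smul_apply, smul_eq_mul]
    ring
  refine ⟨hmap, ⟨fun ℓ hℓ => hmap ℓ hℓ, ?_, fun ℓ hℓ => ⟨_, hmap ℓ hℓ, hinv ℓ⟩⟩, ?_⟩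
  · intro a _ b _ hab
    have hab' : a + (2 * herm6 a r) • r = b + (2 * herm6 b r) • r := hab
    rw [← hinv a, hab', hinv b]
  · intro v w _ _
    rw [herm6_add_smul, herm6_add_smul_right, herm6_add_smul_right, hrr, map_mul, herm6_conj,
      map_ofNat]
    ring
end
end

section
/- For the Hermitian lattice Λ₆ = ℤ[i]⁶ with Gram matrix G as below: for every special-even vector r ∈ Λ₆ with ⟨r,r⟩ = −2 (special-even meaning Re⟨v,r⟩ ∈ ℤ for all v ∈ Λ₆), the reflection τ_{r,−1}, given by τ_{r,−1}(ℓ) = ℓ + ⟨ℓ,r⟩·r, maps Λ₆ into Λ₆; consequently τ_{r,−1} ∈ U(Λ₆). -/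
noncomputable section

open Complex

/-- `r` is special-even: `Re⟨v,r⟩ ∈ ℤ` for every `v ∈ Λ₆`. -/
def SpecialEven6 (r : Fin 6 → ℂ) : Prop :=
  ∀ v : Fin 6 → ℂ, lat6 v → ∃ m : ℤ, (herm6 v r).re = (m : ℝ)

theorem herm6_add_left (u v w : Fin 6 → ℂ) :
    herm6 (u + v) w = herm6 u w + herm6 v w := by
  simp only [herm6, ← Finset.sum_add_distrib, Pi.add_apply]
  refine Finset.sum_congr rfl fun j _ => Finset.sum_congr rfl fun k _ => ?_
  ring

theorem herm6_smul_left (c : ℂ) (v w : Fin 6 → ℂ) :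
    herm6 (c • v) w = c * herm6 v w := by
  simp only [herm6, Finset.mul_sum, Pi.smul_apply, smul_eq_mul]
  refine Finset.sum_congr rfl fun j _ => Finset.sum_congr rfl fun k _ => ?_
  ring

theorem herm6_add_right (u v w : Fin 6 → ℂ) :
    herm6 w (u + v) = herm6 w u + herm6 w v := by
  rw [← herm6_conj, herm6_add_left, map_add, herm6_conj, herm6_conj]

theorem herm6_smul_right (c : ℂ) (v w : Fin 6 → ℂ) :
    herm6 w (c • v) = (starRingEnd ℂ) c * herm6 w v := by
  rw [← herm6_conj, herm6_smul_left, map_mul, herm6_conj]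

theorem inGZ_herm6 {r v : Fin 6 → ℂ} (hse : SpecialEven6 r) (hv : lat6 v) :
    inGZ (herm6 v r) := by
  obtain ⟨m, hm⟩ := hse v hv
  obtain ⟨n, hn⟩ := hse (Complex.I • v) fun j => inGZ_mul ⟨0, 1, by simp⟩ (hv j)
  rw [herm6_smul_left] at hn
  refine ⟨m, -n, ?_⟩
  apply Complex.ext
  · simp [hm]
  · simp [← hn]

/-- For every special-even `r ∈ Λ₆` with `⟨r,r⟩ = -2`, the reflection
`τ_{r,-1} : ℓ ↦ ℓ + ⟨ℓ,r⟩·r` maps `Λ₆` into `Λ₆`; consequently `τ_{r,-1} ∈ U(Λ₆)`, i.e. it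
restricts to a (ℤ[i]-linear) automorphism of `Λ₆` preserving `⟨·,·⟩`. -/
theorem reflection_specialEven_mem_unitary_lat6
    (r : Fin 6 → ℂ) (hr : lat6 r) (hse : SpecialEven6 r) (hrr : herm6 r r = -2) :
    (∀ ℓ, lat6 ℓ → lat6 (ℓ + herm6 ℓ r • r)) ∧
    Set.BijOn (fun ℓ : Fin 6 → ℂ => ℓ + herm6 ℓ r • r) {v | lat6 v} {v | lat6 v} ∧
    (∀ v w : Fin 6 → ℂ, lat6 v → lat6 w →
      herm6 (v + herm6 v r • r) (w + herm6 w r • r) = herm6 v w) := by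
  have h1 : ∀ ℓ, lat6 ℓ → lat6 (ℓ + herm6 ℓ r • r) := fun ℓ hl j =>
    inGZ_add (hl j) (inGZ_mul (inGZ_herm6 hse hl) (hr j))
  have h2 : ∀ ℓ : Fin 6 → ℂ,
      (ℓ + herm6 ℓ r • r) + herm6 (ℓ + herm6 ℓ r • r) r • r = ℓ := by
    intro ℓ
    rw [herm6_add_left, herm6_smul_left, hrr]
    ext j
    simp only [Pi.add_apply, Pi.smul_apply, smul_eq_mul]
    ring
  refine ⟨h1, ⟨fun ℓ hl => h1 ℓ hl, ?_, fun ℓ hl => ⟨_, h1 ℓ hl, h2 ℓ⟩⟩, ?_⟩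
  · intro a _ b _ hab
    have hab' : a + herm6 a r • r = b + herm6 b r • r := hab
    rw [← h2 a, hab', h2 b]
  · intro v w _ _
    simp only [herm6_add_left, herm6_add_right, herm6_smul_left, herm6_smul_right, hrr,
      herm6_conj]
    ring
end
end

section
/- For the Hermitian lattice Λ′₆ = ℤ[√−2]⁶ with Gram matrix G′ as below: for every r ∈ Λ′₆ with ⟨r,r⟩ = −1, the reflection τ_{r,−1}, given by τ_{r,−1}(ℓ) = ℓ + 2⟨ℓ,r⟩·r, maps Λ′₆ into Λ′₆; consequently τ_{r,−1} ∈ U(Λ′₆). -/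
noncomputable section

open Complex

/-- `√-2 := i√2` as a complex number. -/
def sqrtNeg2 : ℂ := Complex.I * Real.sqrt 2

/-- `z` lies in `ℤ[√-2] ⊆ ℂ`. -/
def inO2 (z : ℂ) : Prop := ∃ a b : ℤ, z = (a : ℂ) + (b : ℂ) * sqrtNeg2

/-- A vector lies in the lattice `Λ′₆ = ℤ[√-2]⁶`. -/
def lat6' (v : Fin 6 → ℂ) : Prop := ∀ j, inO2 (v j)

/-- The Gram matrix `G′`: block diagonal with blocks `G′₁ = [[0,1/2],[1/2,0]]` (the Gram
matrix of `Λ′_{U⊕U(2)}`) and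
`G′₂ = -[[2,0,√-2+1,(1/2)√-2],[0,2,(1/2)√-2,1-√-2],[1-√-2,-(1/2)√-2,2,0],[-(1/2)√-2,√-2+1,0,2]]`
(the Gram matrix of `Λ′_{E8(-1)}(2)`). -/
def G6' : Matrix (Fin 6) (Fin 6) ℂ :=
  !![0, 1/2, 0, 0, 0, 0;
     1/2, 0, 0, 0, 0, 0;
     0, 0, -2, 0, -(sqrtNeg2 + 1), -(sqrtNeg2 / 2);
     0, 0, 0, -2, -(sqrtNeg2 / 2), -(1 - sqrtNeg2);
     0, 0, -(1 - sqrtNeg2), sqrtNeg2 / 2, -2, 0;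
     0, 0, sqrtNeg2 / 2, -(sqrtNeg2 + 1), 0, -2]

/-- The Hermitian form `⟨v,w⟩ = Σ_{j,k} G′_{jk} v_j conj(w_k)` on `ℂ⁶`. -/
def herm6' (v w : Fin 6 → ℂ) : ℂ :=
  ∑ j : Fin 6, ∑ k : Fin 6, G6' j k * v j * (starRingEnd ℂ) (w k)

theorem sqrtNeg2_sq : sqrtNeg2 * sqrtNeg2 = -2 := by
  have h : ((Real.sqrt 2 : ℝ) : ℂ) * ((Real.sqrt 2 : ℝ) : ℂ) = 2 := by
    rw [← Complex.ofReal_mul, Real.mul_self_sqrt (by norm_num)]; norm_num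
  unfold sqrtNeg2
  linear_combination (Complex.I * Complex.I) * h + 2 * Complex.I_mul_I

theorem conj_sqrtNeg2 : (starRingEnd ℂ) sqrtNeg2 = -sqrtNeg2 := by
  simp [sqrtNeg2]

theorem inO2_add {x y : ℂ} (hx : inO2 x) (hy : inO2 y) : inO2 (x + y) := by
  obtain ⟨a, b, rfl⟩ := hx
  obtain ⟨c, d, rfl⟩ := hy
  exact ⟨a + c, b + d, by push_cast; ring⟩

theorem inO2_mul {x y : ℂ} (hx : inO2 x) (hy : inO2 y) : inO2 (x * y) := by
  obtain ⟨a, b, rfl⟩ := hx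
  obtain ⟨c, d, rfl⟩ := hy
  refine ⟨a * c - 2 * b * d, a * d + b * c, ?_⟩
  push_cast
  linear_combination ((b : ℂ) * d) * sqrtNeg2_sq

theorem inO2_conj {x : ℂ} (hx : inO2 x) : inO2 ((starRingEnd ℂ) x) := by
  obtain ⟨a, b, rfl⟩ := hx
  exact ⟨a, -b, by simp [conj_sqrtNeg2]⟩

theorem inO2_sum (f : Fin 6 → ℂ) (h : ∀ j, inO2 (f j)) : inO2 (∑ j, f j) := by
  simp only [Fin.sum_univ_six]
  exact inO2_add (inO2_add (inO2_add (inO2_add (inO2_add (h 0) (h 1)) (h 2)) (h 3)) (h 4)) (h 5)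

theorem two_G6'_eq (j k : Fin 6) : inO2 (2 * G6' j k) := by
  have key : ∀ (z : ℂ) (a b : ℤ), 2 * z = (a : ℂ) + (b : ℂ) * sqrtNeg2 → inO2 (2 * z) :=
    fun z a b h => ⟨a, b, h⟩
  fin_cases j <;> fin_cases k <;> simp only [G6'] <;>
  first
  | (refine key _ 0 0 ?_; simp; done)
  | (refine key _ 1 0 ?_; simp; done)
  | (refine key _ (-4) 0 ?_; simp; norm_num; done)
  | (refine key _ (-2) (-2) ?_; simp; ring1; done)
  | (refine key _ (-2) 2 ?_; simp; ring1; done)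
  | (refine key _ 0 1 ?_; simp; ring1; done)
  | (refine key _ 0 (-1) ?_; simp; ring1; done)

theorem conj_G6' (j k : Fin 6) : (starRingEnd ℂ) (G6' j k) = G6' k j := by
  have h2 : (starRingEnd ℂ) (2 : ℂ) = 2 := map_ofNat _ 2
  fin_cases j <;> fin_cases k <;> simp [G6', conj_sqrtNeg2, h2] <;> ring1

theorem herm6'_conj (v w : Fin 6 → ℂ) : (starRingEnd ℂ) (herm6' v w) = herm6' w v := by
  unfold herm6'
  rw [map_sum, Finset.sum_congr rfl (fun j _ => map_sum _ _ _), Finset.sum_comm]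
  refine Finset.sum_congr rfl fun j _ => Finset.sum_congr rfl fun k _ => ?_
  rw [map_mul, map_mul, conj_G6', Complex.conj_conj]
  ring

theorem herm6'_add_smul_left (v w r : Fin 6 → ℂ) (a : ℂ) :
    herm6' (v + a • r) w = herm6' v w + a * herm6' r w := by
  unfold herm6'
  simp only [Finset.mul_sum, ← Finset.sum_add_distrib]
  refine Finset.sum_congr rfl fun j _ => Finset.sum_congr rfl fun k _ => ?_
  simp only [Pi.add_apply, Pi.smul_apply, smul_eq_mul]
  ring

theorem herm6'_add_smul_right (v w r : Fin 6 → ℂ) (a : ℂ) :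
    herm6' v (w + a • r) = herm6' v w + (starRingEnd ℂ) a * herm6' v r := by
  rw [← herm6'_conj, herm6'_add_smul_left, map_add, map_mul, herm6'_conj, herm6'_conj]

theorem inO2_two_herm6' {v w : Fin 6 → ℂ} (hv : lat6' v) (hw : lat6' w) :
    inO2 (2 * herm6' v w) := by
  unfold herm6'
  simp only [Finset.mul_sum]
  refine inO2_sum _ fun j => inO2_sum _ fun k => ?_
  rw [← mul_assoc, ← mul_assoc]
  exact inO2_mul (inO2_mul (two_G6'_eq j k) (hv j)) (inO2_conj (hw k))

/-- For every `r ∈ Λ′₆` with `⟨r,r⟩ = -1`, the reflection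
`τ_{r,-1} : ℓ ↦ ℓ + 2⟨ℓ,r⟩·r` maps `Λ′₆` into `Λ′₆`; consequently `τ_{r,-1} ∈ U(Λ′₆)`, i.e. it
restricts to a (`ℤ[√-2]`-linear) automorphism of `Λ′₆` preserving `⟨·,·⟩`. -/
theorem reflection_neg_one_mem_unitary_lat6'
    (r : Fin 6 → ℂ) (hr : lat6' r) (hrr : herm6' r r = -1) :
    (∀ ℓ, lat6' ℓ → lat6' (ℓ + (2 * herm6' ℓ r) • r)) ∧
    Set.BijOn (fun ℓ : Fin 6 → ℂ => ℓ + (2 * herm6' ℓ r) • r) {v | lat6' v} {v | lat6' v} ∧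
    (∀ v w : Fin 6 → ℂ, lat6' v → lat6' w →
      herm6' (v + (2 * herm6' v r) • r) (w + (2 * herm6' w r) • r) = herm6' v w) := by
  have h1 : ∀ ℓ, lat6' ℓ → lat6' (ℓ + (2 * herm6' ℓ r) • r) := fun ℓ hℓ j =>
    inO2_add (hℓ j) (inO2_mul (inO2_two_herm6' hℓ hr) (hr j))
  have hinv : ∀ ℓ : Fin 6 → ℂ, (ℓ + (2 * herm6' ℓ r) • r) +
      (2 * herm6' (ℓ + (2 * herm6' ℓ r) • r) r) • r = ℓ := by
    intro ℓ
    rw [herm6'_add_smul_left, hrr]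
    ext j
    simp only [Pi.add_apply, Pi.smul_apply, smul_eq_mul]
    ring
  refine ⟨h1, ⟨fun ℓ hℓ => h1 ℓ hℓ, ?_, ?_⟩, ?_⟩
  · intro v _ w _ hvw
    have hvw' : v + (2 * herm6' v r) • r = w + (2 * herm6' w r) • r := hvw
    rw [← hinv v, hvw', hinv w]
  · intro v hv
    exact ⟨_, h1 v hv, hinv v⟩
  · intro v w _ _
    rw [herm6'_add_smul_left, herm6'_add_smul_right, herm6'_add_smul_right, hrr, map_mul,
      herm6'_conj, map_ofNat]
    ring
end
end

section
/- Let h be the Hermitian form on ℤ[i]⁴ with Gram matrix −(1/2)M, where M = [[2, −i, −i, 1],[i, 2, 1, i],[i, 1, 2, 1],[1, −i, 1, 2]] (Iyanaga's matrix), and let b(v,w) = h(v,w) + conj(h(v,w)) be the associated trace form, an integral symmetric bilinear form on ℤ[i]⁴ regarded as ℤ⁸ via the ℤ-basis e₁,e₂,e₃,e₄,ie₁,ie₂,ie₃,ie₄. Then (ℤ⁸, b) is isometric to the root lattice E₈(−1): there exists a matrix P ∈ GL₈(ℤ) such that Pᵀ B P = −C, where B is the Gram matrix of b in this basis and C = [[2,−1,0,0,0,0,0,0],[−1,2,−1,0,0,0,0,0],[0,−1,2,−1,0,0,0,−1],[0,0,−1,2,−1,0,0,0],[0,0,0,−1,2,−1,0,0],[0,0,0,0,−1,2,−1,0],[0,0,0,0,0,−1,2,0],[0,0,−1,0,0,0,0,2]]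 is a Gram matrix of the E₈ root lattice. -/
noncomputable section

open Complex

/-- Iyanaga's matrix `M`. -/
def iyanaga : Matrix (Fin 4) (Fin 4) ℂ :=
  !![2, -Complex.I, -Complex.I, 1;
     Complex.I, 2, 1, Complex.I;
     Complex.I, 1, 2, 1;
     1, -Complex.I, 1, 2]

/-- The Hermitian form on `ℤ[i]⁴` with Gram matrix `-(1/2)M`. -/
def hIyanaga (v w : Fin 4 → ℂ) : ℂ :=
  ∑ j : Fin 4, ∑ k : Fin 4, (-(1/2 : ℂ)) * iyanaga j k * v j * (starRingEnd ℂ) (w k)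

/-- The `ℤ`-basis `e₁, e₂, e₃, e₄, ie₁, ie₂, ie₃, ie₄` of `ℤ[i]⁴` viewed as `ℤ⁸`. -/
def basis8 : Fin 8 → Fin 4 → ℂ := fun j k =>
  if (j : ℕ) % 4 = (k : ℕ) then (if (j : ℕ) < 4 then 1 else Complex.I) else 0

/-- The Gram matrix of the trace form `b(v,w) = h(v,w) + conj(h(v,w))` in this `ℤ`-basis. -/
def B8 : Matrix (Fin 8) (Fin 8) ℂ :=
  Matrix.of fun j k =>
    hIyanaga (basis8 j) (basis8 k) + (starRingEnd ℂ) (hIyanaga (basis8 j) (basis8 k))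

/-- A Gram matrix `C` of the `E₈` root lattice. -/
def E8gram : Matrix (Fin 8) (Fin 8) ℤ :=
  !![2, -1, 0, 0, 0, 0, 0, 0;
     -1, 2, -1, 0, 0, 0, 0, 0;
     0, -1, 2, -1, 0, 0, 0, -1;
     0, 0, -1, 2, -1, 0, 0, 0;
     0, 0, 0, -1, 2, -1, 0, 0;
     0, 0, 0, 0, -1, 2, -1, 0;
     0, 0, 0, 0, 0, -1, 2, 0;
     0, 0, -1, 0, 0, 0, 0, 2]

/-- Columns are simple roots of `E₈` inside the lattice. -/
def isoP : Matrix (Fin 8) (Fin 8) ℤ :=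
  !![-1, 0, 0, 0, 0, 0, 1, 0;
     0, 0, 0, 0, -1, 0, 0, 1;
     0, 0, 0, 0, 0, 1, 1, -1;
     0, 0, 0, 0, 0, 0, -2, 1;
     0, 0, 0, 0, 0, 0, -1, 0;
     0, -1, 1, 0, 0, 0, -1, 0;
     0, 0, -1, 0, 0, 0, 1, 1;
     0, 0, 0, 1, 0, 0, 0, -1]

/-- The inverse of `isoP`. -/
def isoQ : Matrix (Fin 8) (Fin 8) ℤ :=
  !![-1, 0, 0, 0, -1, 0, 0, 0;
     0, 0, 0, 1, -2, -1, -1, 0;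
     0, 0, 0, 1, -3, 0, -1, 0;
     0, 0, 0, 1, -2, 0, 0, 1;
     0, -1, 0, 1, -2, 0, 0, 0;
     0, 0, 1, 1, -1, 0, 0, 0;
     0, 0, 0, 0, -1, 0, 0, 0;
     0, 0, 0, 1, -2, 0, 0, 0]

/-- The integral Gram matrix of the trace form. -/
def gramZ : Matrix (Fin 8) (Fin 8) ℤ :=
  !![-2, 0, 0, -1, 0, 1, 1, 0;
     0, -2, -1, 0, -1, 0, 0, -1;
     0, -1, -2, -1, -1, 0, 0, 0;
     -1, 0, -1, -2, 0, 1, 0, 0;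
     0, -1, -1, 0, -2, 0, 0, -1;
     1, 0, 0, 1, 0, -2, -1, 0;
     1, 0, 0, 0, 0, -1, -2, -1;
     0, -1, 0, 0, -1, 0, -1, -2]

lemma isoP_mul_isoQ : isoP * isoQ = 1 := by decide +kernel

lemma iso_gram : isoP.transpose * gramZ * isoP = -E8gram := by decide +kernel

set_option maxHeartbeats 4000000 in
lemma B8_eq : B8 = gramZ.map (Int.cast : ℤ → ℂ) := by
  ext j k
  fin_cases j <;> fin_cases k <;>
    (simp [B8, hIyanaga, basis8, iyanaga, gramZ, Fin.sum_univ_four, Complex.ext_iff] <;> norm_num)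

/-- The trace form of the Hermitian form on `ℤ[i]⁴` with Gram matrix
`-(1/2)M` (M Iyanaga's matrix), viewed as an integral symmetric bilinear form on `ℤ⁸`, is
isometric to the root lattice `E₈(-1)`: there is `P ∈ GL₈(ℤ)` with `Pᵀ B P = -C`. -/
theorem traceForm_iyanaga_isometric_E8_neg :
    ∃ P : Matrix (Fin 8) (Fin 8) ℤ, IsUnit P.det ∧
      (P.map (Int.cast : ℤ → ℂ)).transpose * B8 * P.map (Int.cast : ℤ → ℂ)
        = -(E8gram.map (Int.cast : ℤ → ℂ)) := by
  refine ⟨isoP, ?_, ?_⟩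
  · have h := congrArg Matrix.det isoP_mul_isoQ
    rw [Matrix.det_mul, Matrix.det_one] at h
    exact IsUnit.of_mul_eq_one _ h
  · rw [B8_eq]
    have h := congrArg (fun X : Matrix (Fin 8) (Fin 8) ℤ => X.map (Int.castRingHom ℂ)) iso_gram
    simp only [Matrix.map_mul, Matrix.transpose_map] at h
    refine h.trans ?_
    ext i j
    simp
end
end
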